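/- Under the conditions of the quantitative main theorem (X a Banach space with modulus of uniform convexity Φ, T : C → C with B_r[p] ⊆ Fix(T), r/K ≤ 2, x ∈ C with ‖x − p‖ < K, Γ a metastable rate of asymptotic decreasingness for (‖T^n x − q‖)_{n∈ℕ} uniform in q ∈ B_r[p]), for any ε > 0 with ε/(2K) ∈ (0,4] there exists n ≤ Ω(Φ, Γ, K, r, ε, g), where g(k) := k + 1, such that T^n x is an ε-fixed point of T, i.e. ‖T(T^n x) − T^n x‖ ≤ ε. -/

import Mathlib

/-- `fStar g n = max_{i ≤ n} max (n, g i)`. -/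
def fStar (g : ℕ → ℕ) (n : ℕ) : ℕ := (Finset.range (n + 1)).sup fun i => max n (g i)

/-- `ΓStar Γ K r ε g N = max_{i ≤ N} max (N, Γ K r ε g i)`. -/
def ΓStar (Γ : ℝ → ℝ → ℝ → (ℕ → ℕ) → ℕ → ℕ) (K r ε : ℝ) (g : ℕ → ℕ) (N : ℕ) : ℕ :=
  (Finset.range (N + 1)).sup fun i => max N (Γ K r ε g i)

/-- `Ψ(h, ε') := min (ε'/2) (2h·Φ(ε'/2))`. -/
noncomputable def Psi (Φ : ℝ → ℝ) (h ε' : ℝ) : ℝ := min (ε' / 2) (2 * h * Φ (ε' / 2))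

/-- `η := (r/4)·min 1 (Ψ (min (1/4) (r/K)) (ε/(2K)))`. -/
noncomputable def eta (Φ : ℝ → ℝ) (K r ε : ℝ) : ℝ :=
  r / 4 * min 1 (Psi Φ (min (1 / 4) (r / K)) (ε / (2 * K)))

/-- `f j := Γ*(K, r, η, g, j) + g*(Γ*(K, r, η, g, j))`. -/
def fIter (Γ : ℝ → ℝ → ℝ → (ℕ → ℕ) → ℕ → ℕ) (K r η : ℝ) (g : ℕ → ℕ) (j : ℕ) : ℕ :=
  ΓStar Γ K r η g j + fStar g (ΓStar Γ K r η g j)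

/-- `Ω(Φ, Γ, K, r, ε, g) := Γ*(K, r, η, g, f^(⌈K/η⌉)(0))`. -/
noncomputable def Omega (Φ : ℝ → ℝ) (Γ : ℝ → ℝ → ℝ → (ℕ → ℕ) → ℕ → ℕ) (K r ε : ℝ)
    (g : ℕ → ℕ) : ℕ :=
  ΓStar Γ K r (eta Φ K r ε) g ((fIter Γ K r (eta Φ K r ε) g)^[⌈K / eta Φ K r ε⌉₊] 0)

theorem fStar_mono (g : ℕ → ℕ) : Monotone (fStar g) := fun m n h =>
  Finset.sup_le fun i hi =>
    (max_le_max_right (g i) h).trans <|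
      Finset.le_sup (f := fun i => max n (g i)) (Finset.range_subset_range.2 (by omega) hi)

theorem le_fStar (g : ℕ → ℕ) {i n : ℕ} (h : i ≤ n) : g i ≤ fStar g n :=
  (le_max_right n (g i)).trans <|
    Finset.le_sup (f := fun i => max n (g i)) (Finset.mem_range.2 (by omega))

theorem ΓStar_mono (Γ : ℝ → ℝ → ℝ → (ℕ → ℕ) → ℕ → ℕ) (K r ε : ℝ) (g : ℕ → ℕ) :
    Monotone (ΓStar Γ K r ε g) := fStar_mono (Γ K r ε g)

theorem le_ΓStar (Γ : ℝ → ℝ → ℝ → (ℕ → ℕ) → ℕ → ℕ) (K r ε : ℝ) (g : ℕ → ℕ) (N : ℕ) :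
    Γ K r ε g N ≤ ΓStar Γ K r ε g N := le_fStar (Γ K r ε g) le_rfl

theorem fIter_mono (Γ : ℝ → ℝ → ℝ → (ℕ → ℕ) → ℕ → ℕ) (K r η : ℝ) (g : ℕ → ℕ) :
    Monotone (fIter Γ K r η g) := fun _ _ h =>
  add_le_add (ΓStar_mono Γ K r η g h) (fStar_mono g (ΓStar_mono Γ K r η g h))

/-- A nonnegative sequence cannot decrease by `η` more than `⌈K / η⌉` times, so a search in which
every failure yields such a decrease within the bound `f` succeeds below `f^[⌈K / η⌉] 0`. -/
theorem exists_le_iterate_of_or_decrease {f : ℕ → ℕ} (hf : Monotone f) {b : ℕ → ℝ}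
    (hb : ∀ n, 0 ≤ b n) {K η : ℝ} (hη : 0 < η) (hb0 : b 0 < K) {P : ℕ → Prop}
    (h : ∀ N, b N < K → P N ∨ ∃ i ≤ f N, b i < b N - η) :
    ∃ N ≤ f^[⌈K / η⌉₊] 0, P N := by
  have hmono := hf.monotone_iterate_of_le_map (Nat.zero_le (f 0))
  have key : ∀ j : ℕ, (∃ N ≤ f^[j] 0, P N) ∨ ∃ N ≤ f^[j] 0, b N < K - j * η := by
    intro j
    induction j with
    | zero => exact Or.inr ⟨0, le_rfl, by simpa using hb0⟩
    | succ j ih =>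
      rcases ih with ⟨N, hN, hP⟩ | ⟨N, hN, hlt⟩
      · exact Or.inl ⟨N, hN.trans (hmono j.le_succ), hP⟩
      · have hj : 0 ≤ (j : ℝ) * η := by positivity
        rcases h N (by linarith) with hP | ⟨i, hi, hbi⟩
        · exact Or.inl ⟨N, hN.trans (hmono j.le_succ), hP⟩
        · refine Or.inr ⟨i, ?_, ?_⟩
          · rw [Function.iterate_succ_apply']
            exact hi.trans (hf hN)
          · push_cast
            linarith
  rcases key ⌈K / η⌉₊ with hP | ⟨N, -, hlt⟩
  · exact hP
  · have h1 : K ≤ ⌈K / η⌉₊ * η := (div_le_iff₀ hη).1 (Nat.le_ceil _)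
    linarith [hb N]

section UniformConvexity

variable {X : Type*} [NormedAddCommGroup X] [NormedSpace ℝ X]

/-- Uniform convexity at scale `M`. -/
theorem norm_add_lt_of_lt_norm_sub {δ φ : ℝ}
    (hφ : ∀ x₁ x₂ : X, ‖x₁‖ ≤ 1 → ‖x₂‖ ≤ 1 → (1 : ℝ) / 2 * ‖x₁ + x₂‖ ≥ 1 - φ → ‖x₁ - x₂‖ ≤ δ)
    {M : ℝ} (hM : 0 < M) {u v : X} (hu : ‖u‖ ≤ M) (hv : ‖v‖ ≤ M) (huv : M * δ < ‖u - v‖) :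
    ‖u + v‖ < 2 * M * (1 - φ) := by
  by_contra! hge
  have hnorm : ∀ w : X, ‖M⁻¹ • w‖ = ‖w‖ / M := fun w => by
    rw [norm_smul, norm_inv, Real.norm_of_nonneg hM.le, inv_mul_eq_div]
  have h := hφ (M⁻¹ • u) (M⁻¹ • v)
    (by rw [hnorm]; exact (div_le_one hM).2 hu) (by rw [hnorm]; exact (div_le_one hM).2 hv)
    (by
      rw [← smul_add, hnorm, ge_iff_le, mul_div_assoc', le_div_iff₀ hM]
      linarith)
  rw [← smul_sub, hnorm, div_le_iff₀ hM] at h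
  linarith

/-- If `z` is not much closer to `0` than `v`, and not much farther than `v` from the point `h • v`,
then `z` is close to `v`. -/
theorem norm_sub_le_of_norm_sub_smul_le {δ φ : ℝ} (hφ0 : 0 < φ)
    (hφ : ∀ x₁ x₂ : X, ‖x₁‖ ≤ 1 → ‖x₂‖ ≤ 1 → (1 : ℝ) / 2 * ‖x₁ + x₂‖ ≥ 1 - φ → ‖x₁ - x₂‖ ≤ δ)
    {h η : ℝ} (h0 : 0 < h) (h4 : h ≤ 1 / 4) (hη0 : 0 ≤ η) {v z : X} (hv : 0 < ‖v‖)
    (hη : η ≤ ‖v‖ / 4 * (2 * h * φ))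
    (hz : ‖v‖ - η ≤ ‖z‖) (hzq : ‖z - h • v‖ ≤ (1 - h) * ‖v‖ + η) :
    ‖z - v‖ ≤ ((1 - h) * ‖v‖ + η) * δ := by
  have h1 : 0 < 1 - h := by linarith
  set M : ℝ := ‖v‖ + η / (1 - h) with hMdef
  have hηM : η / (1 - h) ≤ 4 / 3 * η := by
    rw [div_le_iff₀ h1]
    nlinarith
  have hMmul : (1 - h) * M = (1 - h) * ‖v‖ + η := by
    rw [hMdef]
    field_simp
  have hvM : ‖v‖ ≤ M := le_add_of_nonneg_right (by positivity)
  have hM : 0 < M := hv.trans_le hvM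
  set u : X := (1 - h)⁻¹ • (z - h • v) with hudef
  have hzu : z = (1 - h) • u + h • v := by
    rw [hudef, smul_inv_smul₀ h1.ne', sub_add_cancel]
  have huM : ‖u‖ ≤ M := by
    rw [hudef, norm_smul, norm_inv, Real.norm_of_nonneg h1.le, inv_mul_le_iff₀ h1, hMmul]
    exact hzq
  have hzv : z - v = (1 - h) • (u - v) := by
    rw [hzu]
    module
  rw [hzv, norm_smul, Real.norm_of_nonneg h1.le, ← hMmul, mul_assoc]
  refine mul_le_mul_of_nonneg_left ?_ h1.le
  by_contra! huv
  have hadd := norm_add_lt_of_lt_norm_sub hφ hM huM hvM huv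
  have hzle : ‖z‖ ≤ h * ‖u + v‖ + (1 - 2 * h) * ‖u‖ := by
    have hz' : z = h • (u + v) + (1 - 2 * h) • u := by
      rw [hzu]
      module
    calc ‖z‖ = ‖h • (u + v) + (1 - 2 * h) • u‖ := congrArg _ hz'
      _ ≤ ‖h • (u + v)‖ + ‖(1 - 2 * h) • u‖ := norm_add_le _ _
      _ = h * ‖u + v‖ + (1 - 2 * h) * ‖u‖ := by
        rw [norm_smul, norm_smul, Real.norm_of_nonneg h0.le,
          Real.norm_of_nonneg (by linarith : (0 : ℝ) ≤ 1 - 2 * h)]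
  have e1 : h * ‖u + v‖ < h * (2 * M * (1 - φ)) := mul_lt_mul_of_pos_left hadd h0
  have e2 : (1 - 2 * h) * ‖u‖ ≤ (1 - 2 * h) * M :=
    mul_le_mul_of_nonneg_left huM (by linarith)
  have e3 : ‖v‖ * (2 * h * φ) ≤ M * (2 * h * φ) :=
    mul_le_mul_of_nonneg_right hvM (by positivity)
  have e4 : 0 < M * (2 * h * φ) := by positivity
  linarith

end UniformConvexity

/-- Under the conditions of the quantitative main theorem, for any `ε > 0` with
`ε/(2K) ∈ (0,4]` there exists `n ≤ Ω(Φ, Γ, K, r, ε, g)` with `g k := k + 1` such that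
`T^n x` is an `ε`-fixed point of `T`. -/
theorem stmt15 {X : Type*} [NormedAddCommGroup X] [NormedSpace ℝ X] [CompleteSpace X]
    (Φ : ℝ → ℝ) (hΦrange : ∀ ε ∈ Set.Ioc (0 : ℝ) 2, Φ ε ∈ Set.Ioc (0 : ℝ) 1)
    (hΦ : ∀ x₁ x₂ : X, ‖x₁‖ ≤ 1 → ‖x₂‖ ≤ 1 → ∀ ε ∈ Set.Ioc (0 : ℝ) 2,
      (1 : ℝ) / 2 * ‖x₁ + x₂‖ ≥ 1 - Φ ε → ‖x₁ - x₂‖ ≤ ε)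
    (C : Set X) (T : X → X) (hT : Set.MapsTo T C C)
    (p : X) (r : ℝ) (hr : 0 < r)
    (hball : Metric.closedBall p r ⊆ {y | y ∈ C ∧ T y = y})
    (x : X) (hx : x ∈ C) (K : ℝ) (hK : 0 < K) (hxp : ‖x - p‖ < K) (hrK : r / K ≤ 2)
    (Γ : ℝ → ℝ → ℝ → (ℕ → ℕ) → ℕ → ℕ)
    (hΓ : ∀ ε > (0 : ℝ), ∀ g : ℕ → ℕ, ∀ N : ℕ, ∀ q ∈ Metric.closedBall p r,
      ∃ n ≤ Γ K r ε g N, ∀ i ∈ Set.Icc n (n + g n), ‖T^[i] x - q‖ ≤ ‖T^[N] x - q‖ + ε) :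
    ∀ ε > (0 : ℝ), ε / (2 * K) ∈ Set.Ioc (0 : ℝ) 4 →
      ∃ n ≤ Omega Φ Γ K r ε (fun k => k + 1), ‖T (T^[n] x) - T^[n] x‖ ≤ ε := by
  intro ε hε hεK
  set g : ℕ → ℕ := fun k => k + 1 with hg
  set δ : ℝ := ε / (2 * K) / 2 with hδ
  have hδmem : δ ∈ Set.Ioc (0 : ℝ) 2 := ⟨half_pos hεK.1, by linarith [hεK.2]⟩
  have hδε : 2 * K * δ = ε / 2 := by
    rw [hδ]
    field_simp
  have hφ0 : 0 < Φ δ := (hΦrange δ hδmem).1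
  set h : ℝ := min (1 / 4) (r / K)
  have h0 : 0 < h := lt_min (by norm_num) (by positivity)
  have h4 : h ≤ 1 / 4 := min_le_left _ _
  have hhK : h * K ≤ r := (le_div_iff₀ hK).1 (min_le_right _ _)
  have hrK' : r ≤ 2 * K := (div_le_iff₀ hK).1 hrK
  set η : ℝ := eta Φ K r ε
  have hηdef : η = r / 4 * min 1 (min δ (2 * h * Φ δ)) := rfl
  have hη0 : 0 < η := by
    rw [hηdef]
    exact mul_pos (by positivity) (lt_min one_pos (lt_min hδmem.1 (by positivity)))
  have hη1 : η ≤ r / 4 := by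
    rw [hηdef]
    exact mul_le_of_le_one_right (by positivity) (min_le_left _ _)
  have hηδ : η ≤ r / 4 * δ := by
    rw [hηdef]
    exact mul_le_mul_of_nonneg_left ((min_le_right _ _).trans (min_le_left _ _)) (by positivity)
  have hηφ : η ≤ r / 4 * (2 * h * Φ δ) := by
    rw [hηdef]
    exact mul_le_mul_of_nonneg_left ((min_le_right _ _).trans (min_le_right _ _)) (by positivity)
  have step : ∀ N, ‖T^[N] x - p‖ < K →
      (∃ n ≤ Γ K r η g N, ∀ i ∈ Set.Icc n (n + g n), ‖T^[i] x - T^[N] x‖ ≤ ε / 2) ∨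
        ∃ i ≤ fIter Γ K r η g N, ‖T^[i] x - p‖ < ‖T^[N] x - p‖ - η := by
    intro N hN
    rcases le_or_gt ‖T^[N] x - p‖ r with hle | hgt
    · obtain ⟨n, hn, hi⟩ := hΓ η hη0 g N (T^[N] x) (mem_closedBall_iff_norm.2 hle)
      refine Or.inl ⟨n, hn, fun i hin => (hi i hin).trans ?_⟩
      have := mul_le_mul_of_nonneg_right hrK' hδmem.1.le
      rw [sub_self, norm_zero]
      linarith
    · set v : X := T^[N] x - p with hv
      have hq : p + h • v ∈ Metric.closedBall p r := by
        rw [mem_closedBall_iff_norm, add_sub_cancel_left, norm_smul, Real.norm_of_nonneg h0.le]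
        exact (mul_le_mul_of_nonneg_left hN.le h0.le).trans hhK
      obtain ⟨n, hn, hi⟩ := hΓ η hη0 g N _ hq
      by_cases hdec : ∃ i ∈ Set.Icc n (n + g n), ‖T^[i] x - p‖ < ‖v‖ - η
      · obtain ⟨i, hin, hlt⟩ := hdec
        have hnΓ := hn.trans (le_ΓStar Γ K r η g N)
        exact Or.inr ⟨i, hin.2.trans (add_le_add hnΓ (le_fStar g hnΓ)), hlt⟩
      push Not at hdec
      refine Or.inl ⟨n, hn, fun i hin => ?_⟩
      have hNq : ‖T^[N] x - (p + h • v)‖ = (1 - h) * ‖v‖ := by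
        rw [← sub_sub, ← hv, ← Real.norm_of_nonneg (by linarith : (0 : ℝ) ≤ 1 - h), ← norm_smul,
          sub_smul, one_smul]
      have hiq := hi i hin
      rw [hNq, ← sub_sub] at hiq
      have hclose := norm_sub_le_of_norm_sub_smul_le hφ0
        (fun x₁ x₂ h₁ h₂ => hΦ x₁ x₂ h₁ h₂ δ hδmem) h0 h4 hη0.le (hr.trans hgt)
        (hηφ.trans (mul_le_mul_of_nonneg_right (by linarith) (by positivity))) (hdec i hin) hiq
      rw [hv, sub_sub_sub_cancel_right] at hclose
      refine hclose.trans (le_of_le_of_eq (mul_le_mul_of_nonneg_right ?_ hδmem.1.le) hδε)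
      have : 0 ≤ h * ‖v‖ := by positivity
      linarith
  obtain ⟨N, hN, n, hn, hi⟩ := exists_le_iterate_of_or_decrease (fIter_mono Γ K r η g)
    (b := fun n => ‖T^[n] x - p‖) (fun _ => norm_nonneg _) hη0 hxp step
  refine ⟨n, (hn.trans (le_ΓStar Γ K r η g N)).trans (ΓStar_mono Γ K r η g hN), ?_⟩
  rw [← Function.iterate_succ_apply' T]
  have hsucc := hi (n + 1) ⟨n.le_succ, by simp only [hg]; omega⟩
  have hself := hi n ⟨le_rfl, Nat.le_add_right _ _⟩
  calc ‖T^[n + 1] x - T^[n] x‖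
      ≤ ‖T^[n + 1] x - T^[N] x‖ + ‖T^[N] x - T^[n] x‖ := norm_sub_le_norm_sub_add_norm_sub _ _ _
    _ ≤ ε := by
      rw [norm_sub_rev (T^[N] x)]
      linarith
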